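/- Let P = Σ_{i=1}^t λ_i M_i be a quasi-identity of M_n, where M_1,…,M_t are pairwise distinct monomials in x_1,…,x_m and λ_1,…,λ_t ∈ C. If for every i the total degree of λ_i plus the degree of the monomial M_i is strictly less than n, then λ_i = 0 for all i. -/

import Mathlib

open scoped TensorProduct

variable (F : Type*) [Field F] [CharZero F] (n : ℕ)

/-- The commutative coefficient ring `C = F[x_{ij}^{(k)}]`. -/
abbrev CPoly := MvPolynomial (Fin n × Fin n × ℕ) F

/-- The algebra of quasi-polynomials `C⟨X⟩`. -/
abbrev QPoly := FreeAlgebra (CPoly F n) ℕ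

/-- The generic matrix `ξ_k`. -/
noncomputable def genMat (k : ℕ) : Matrix (Fin n) (Fin n) (CPoly F n) :=
  Matrix.of fun i j => MvPolynomial.X (i, j, k)

/-- `Φ : C⟨X⟩ → M_n(C)`, the `C`-algebra map sending `x_k` to `ξ_k`. -/
noncomputable def PhiQ : QPoly F n →ₐ[CPoly F n] Matrix (Fin n) (Fin n) (CPoly F n) :=
  FreeAlgebra.lift _ (genMat F n)

/-- Evaluation of `C` at a sequence of matrices. -/
noncomputable def evalC (A : ℕ → Matrix (Fin n) (Fin n) F) : CPoly F n →ₐ[F] F :=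
  MvPolynomial.aeval fun p => A p.2.2 p.1 p.2.1

/-- Evaluation `ev_A : C⟨X⟩ → M_n(F)`. -/
noncomputable def evalQ (A : ℕ → Matrix (Fin n) (Fin n) F) :
    QPoly F n →ₐ[F] Matrix (Fin n) (Fin n) F :=
  ((evalC F n A).mapMatrix).comp ((PhiQ F n).restrictScalars F)

def IsQuasiIdentity (P : QPoly F n) : Prop :=
  ∀ A : ℕ → Matrix (Fin n) (Fin n) F, evalQ F n A P = 0

/-- Substitution endomorphisms of `C⟨X⟩`. -/
def IsSubstEndo (φ : QPoly F n →ₐ[F] QPoly F n) : Prop :=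
  ∀ (i j : Fin n) (k : ℕ),
    φ (algebraMap (CPoly F n) (QPoly F n) (MvPolynomial.X (i, j, k))) =
      algebraMap (CPoly F n) (QPoly F n) (PhiQ F n (φ (FreeAlgebra.ι (CPoly F n) k)) i j)

def IsTIdeal (I : Set (QPoly F n)) : Prop :=
  (0 : QPoly F n) ∈ I ∧
  (∀ a b : QPoly F n, a ∈ I → b ∈ I → a + b ∈ I) ∧
  (∀ r a : QPoly F n, a ∈ I → r * a ∈ I) ∧
  (∀ r a : QPoly F n, a ∈ I → a * r ∈ I) ∧
  (∀ φ : QPoly F n →ₐ[F] QPoly F n, IsSubstEndo F n φ → ∀ p ∈ I, φ p ∈ I)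

/-- The T-ideal generated by a set. -/
def TIdealSpan (S : Set (QPoly F n)) : Set (QPoly F n) :=
  ⋂₀ {I : Set (QPoly F n) | IsTIdeal F n I ∧ S ⊆ I}

/-- The Cayley–Hamilton quasi-polynomial `q_n`. -/
noncomputable def chQ : QPoly F n :=
  ∑ i ∈ Finset.range (n + 1),
    algebraMap (CPoly F n) (QPoly F n) ((genMat F n 0).charpoly.coeff i) *
      FreeAlgebra.ι (CPoly F n) 0 ^ i

/-- Noncommutative polynomials over `F`. -/
abbrev NCPoly := FreeAlgebra F ℕ

noncomputable def evalNC (A : ℕ → Matrix (Fin n) (Fin n) F) :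
    NCPoly F →ₐ[F] Matrix (Fin n) (Fin n) F :=
  FreeAlgebra.lift F A

def IsCentralPoly (c : NCPoly F) : Prop :=
  ∀ A : ℕ → Matrix (Fin n) (Fin n) F, ∃ α : F,
    evalNC F n A c = α • (1 : Matrix (Fin n) (Fin n) F)

def IsPolyIdentity (c : NCPoly F) : Prop :=
  ∀ A : ℕ → Matrix (Fin n) (Fin n) F, evalNC F n A c = 0

/-- The constant term of a noncommutative polynomial. -/
noncomputable def constantTerm : NCPoly F →ₐ[F] F :=
  FreeAlgebra.lift F (fun _ : ℕ => (0 : F))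

/-- The inclusion `F⟨X⟩ → C⟨X⟩`. -/
noncomputable def toQPoly : NCPoly F →ₐ[F] QPoly F n :=
  FreeAlgebra.lift F (fun k => FreeAlgebra.ι (CPoly F n) k)

/-- The monomial `x_{w 1} ⋯ x_{w r}` in the quasi-polynomial algebra `C⟨X⟩`. -/
noncomputable def monQ (m : ℕ) (w : List (Fin m)) : QPoly F n :=
  (w.map (fun i => FreeAlgebra.ι (CPoly F n) (i : ℕ))).prod

/-- A graph with few edges has many components: some labelling constant along the given pairs
takes at least `card V - E.card` values. -/
theorem exists_card_le_card_image_add {V : Type*} [Fintype V] [DecidableEq V]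
    (E : Finset (V × V)) :
    ∃ h : V → V, (∀ p ∈ E, h p.1 = h p.2) ∧
      Fintype.card V ≤ (Finset.univ.image h).card + E.card := by
  induction E using Finset.induction_on with
  | empty => exact ⟨id, by simp, by simp [Finset.card_univ]⟩
  | insert p E hp ih =>
    obtain ⟨h, hE, hc⟩ := ih
    refine ⟨fun z => if h z = h p.2 then h p.1 else h z, ?_, ?_⟩
    · intro q hq
      rcases Finset.mem_insert.1 hq with rfl | hq
      · simp
      · simp only [hE q hq]
    · have hsub : (Finset.univ.image h).erase (h p.2) ⊆
          Finset.univ.image fun z => if h z = h p.2 then h p.1 else h z := by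
        intro y hy
        obtain ⟨hne, hy⟩ := Finset.mem_erase.1 hy
        obtain ⟨z, -, rfl⟩ := Finset.mem_image.1 hy
        exact Finset.mem_image.2 ⟨z, Finset.mem_univ _, by simp [hne]⟩
      have h1 := Finset.card_le_card hsub
      have h2 := Finset.pred_card_le_card_erase (s := Finset.univ.image h) (a := h p.2)
      rw [Finset.card_insert_of_notMem hp]
      omega

/-- A level function constant along the given pairs and attaining all levels up to `r`. -/
theorem exists_level {V : Type*} [Fintype V] [DecidableEq V] (E : Finset (V × V)) (r : ℕ)
    (hr : E.card + r < Fintype.card V) :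
    ∃ (v : ℕ → V) (l : V → ℕ), (∀ s ≤ r, l (v s) = s) ∧ ∀ p ∈ E, l p.1 = l p.2 := by
  obtain ⟨h, hE, hc⟩ := exists_card_le_card_image_add E
  obtain ⟨e⟩ : Nonempty (Fin (r + 1) ↪ Finset.univ.image h) := by
    rw [Function.Embedding.nonempty_iff_card_le, Fintype.card_fin, Fintype.card_coe]
    omega
  have hv : ∀ s : Fin (r + 1), ∃ z, h z = e s := fun s => by
    obtain ⟨z, -, hz⟩ := Finset.mem_image.1 (e s).2
    exact ⟨z, hz⟩
  choose v hv using hv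
  have hinj : Function.Injective fun s => (e s : V) :=
    Subtype.val_injective.comp e.injective
  refine ⟨fun s => v (Fin.ofNat (r + 1) s),
    fun z => Function.extend (fun s => (e s : V)) Fin.val 0 (h z), ?_, ?_⟩
  · intro s hs
    simp only [hv]
    rw [hinj.extend_apply]
    simp [Nat.mod_eq_of_lt (Nat.lt_succ_of_le hs)]
  · intro p hp
    simp only [hE p hp]

section LevelledMatrices

variable {V R : Type*} [Fintype V] [DecidableEq V] [CommRing R]
  {B : ℕ → Matrix V V R} {l : V → ℕ}

/-- If every matrix raises levels by at most one, a product of `k` of them raises levels by at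
most `k`. -/
theorem level_le_of_list_prod_apply_ne_zero (hB : ∀ k i j, B k i j ≠ 0 → l j ≤ l i + 1)
    (u : List ℕ) (i j : V) (h : (u.map B).prod i j ≠ 0) : l j ≤ l i + u.length := by
  induction u generalizing i with
  | nil =>
    have : i = j := by
      by_contra hij
      simp [hij] at h
    simp [this]
  | cons k u ih =>
    rw [List.map_cons, List.prod_cons, Matrix.mul_apply] at h
    obtain ⟨z, -, hz⟩ := Finset.exists_ne_zero_of_sum_ne_zero h
    have h1 := hB k i z (left_ne_zero_of_mul hz)
    have h2 := ih z (right_ne_zero_of_mul hz)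
    simp only [List.length_cons]
    omega

/-- Suppose the only entries raising the level are those along the path `v` labelled by `w`. Then
a product of the minimal length joining `v s` to the end of the path follows the path. -/
theorem list_prod_apply_path_cons {v : ℕ → V} {w : List ℕ}
    (hv : ∀ s ≤ w.length, l (v s) = s)
    (hB : ∀ k i j, B k i j ≠ 0 →
      l i = l j ∨ ∃ s, ∃ hs : s < w.length, i = v s ∧ j = v (s + 1) ∧ k = w[s])
    (k : ℕ) (u : List ℕ) (s : ℕ) (hs : s + (u.length + 1) = w.length) :
    ((k :: u).map B).prod (v s) (v w.length) =
      B k (v s) (v (s + 1)) * (u.map B).prod (v (s + 1)) (v w.length) := by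
  have hB' : ∀ k i j, B k i j ≠ 0 → l j ≤ l i + 1 := by
    intro k i j h
    rcases hB k i j h with h | ⟨q, hq, rfl, rfl, -⟩
    · omega
    · rw [hv _ hq.le, hv _ hq]
  rw [List.map_cons, List.prod_cons, Matrix.mul_apply]
  refine Finset.sum_eq_single _ (fun z _ hz => ?_) (by simp)
  by_contra hne
  have h1 := level_le_of_list_prod_apply_ne_zero hB' u z _ (right_ne_zero_of_mul hne)
  rw [hv _ le_rfl] at h1
  rcases hB k _ z (left_ne_zero_of_mul hne) with h | ⟨q, hq, hsq, hzq, -⟩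
  · rw [hv s (by omega)] at h
    omega
  · have h2 := congrArg l hsq
    rw [hv s (by omega), hv q hq.le] at h2
    exact hz (h2 ▸ hzq)

theorem eq_drop_of_list_prod_apply_ne_zero {v : ℕ → V} {w : List ℕ}
    (hv : ∀ s ≤ w.length, l (v s) = s)
    (hB : ∀ k i j, B k i j ≠ 0 →
      l i = l j ∨ ∃ s, ∃ hs : s < w.length, i = v s ∧ j = v (s + 1) ∧ k = w[s])
    (u : List ℕ) (s : ℕ) (hs : s + u.length = w.length)
    (h : (u.map B).prod (v s) (v w.length) ≠ 0) : u = w.drop s := by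
  induction u generalizing s with
  | nil => exact (List.drop_eq_nil_of_le (by simpa using hs.ge)).symm
  | cons k u ih =>
    rw [List.length_cons] at hs
    rw [list_prod_apply_path_cons hv hB k u s hs] at h
    have hu := ih (s + 1) (by omega) (right_ne_zero_of_mul h)
    have hk : k = w[s] := by
      rcases hB k _ _ (left_ne_zero_of_mul h) with h | ⟨q, hq, hsq, -, hk⟩
      · rw [hv s (by omega), hv (s + 1) (by omega)] at h
        omega
      · have h2 := congrArg l hsq
        rw [hv s (by omega), hv q hq.le] at h2
        subst h2
        exact hk
    rw [List.drop_eq_getElem_cons (by omega), ← hu, ← hk]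

theorem list_prod_apply_drop_ne_zero [IsDomain R] {v : ℕ → V} {w : List ℕ}
    (hv : ∀ s ≤ w.length, l (v s) = s)
    (hB : ∀ k i j, B k i j ≠ 0 →
      l i = l j ∨ ∃ s, ∃ hs : s < w.length, i = v s ∧ j = v (s + 1) ∧ k = w[s])
    (hw : ∀ s, ∀ hs : s < w.length, B w[s] (v s) (v (s + 1)) ≠ 0)
    (u : List ℕ) (s : ℕ) (hs : s + u.length = w.length) (hu : u = w.drop s) :
    (u.map B).prod (v s) (v w.length) ≠ 0 := by
  induction u generalizing s with
  | nil =>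
    have : s = w.length := by simpa using hs
    simp [this]
  | cons k u ih =>
    rw [List.length_cons] at hs
    rw [list_prod_apply_path_cons hv hB k u s hs]
    rw [List.drop_eq_getElem_cons (by omega), List.cons.injEq] at hu
    exact mul_ne_zero (hu.1 ▸ hw s (by omega)) (ih (s + 1) (by omega) hu.2)

end LevelledMatrices

/-- Setting variables to zero does not change the coefficients of monomials in the remaining
variables. -/
theorem coeff_aeval_ite_X {F σ : Type*} [CommSemiring F] (S : σ → Prop) [DecidablePred S]
    (f : MvPolynomial σ F) (μ : σ →₀ ℕ) (hμ : ∀ p ∈ μ.support, S p) :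
    (MvPolynomial.aeval (fun p => if S p then (MvPolynomial.X p : MvPolynomial σ F) else 0)
      f).coeff μ = f.coeff μ := by
  classical
  induction f using MvPolynomial.induction_on' with
  | add p q hp hq => rw [map_add, MvPolynomial.coeff_add, MvPolynomial.coeff_add, hp, hq]
  | monomial ν a =>
    rw [MvPolynomial.aeval_monomial]
    by_cases hν : ∀ p ∈ ν.support, S p
    · rw [MvPolynomial.monomial_eq, MvPolynomial.algebraMap_eq]
      congr 2
      exact Finsupp.prod_congr fun p hp => by rw [if_pos (hν p hp)]
    · have hne : ν ≠ μ := by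
        rintro rfl
        exact hν hμ
      push Not at hν
      obtain ⟨p, hp, hS⟩ := hν
      rw [MvPolynomial.coeff_monomial, if_neg hne, Finsupp.prod,
        Finset.prod_eq_zero hp (by rw [if_neg hS, zero_pow (Finsupp.mem_support_iff.1 hp)])]
      simp

theorem PhiQ_eq_zero_of_isQuasiIdentity {F : Type*} [Field F] [CharZero F] {n : ℕ}
    {P : QPoly F n} (hP : IsQuasiIdentity F n P) : PhiQ F n P = 0 := by
  ext1 i j
  refine MvPolynomial.funext fun x => ?_
  have h := congrFun (congrFun (hP fun k => Matrix.of fun i j => x (i, j, k)) i) j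
  have h' : MvPolynomial.aeval x (PhiQ F n P i j) = 0 := h
  simpa [MvPolynomial.aeval_eq_eval] using h'

theorem PhiQ_monQ (F : Type*) [Field F] [CharZero F] (n m : ℕ) (w : List (Fin m)) :
    PhiQ F n (monQ F n m w) = ((w.map Fin.val).map (genMat F n)).prod := by
  induction w with
  | nil => simp [monQ]
  | cons i w ih =>
    rw [List.map_cons, List.map_cons, List.prod_cons, ← ih]
    simp [monQ, PhiQ]

theorem stmt12 (F : Type*) [Field F] [CharZero F] (n : ℕ) (hn : 1 ≤ n)
    (m t : ℕ) (w : Fin t → List (Fin m)) (hw : Function.Injective w)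
    (lam : Fin t → CPoly F n)
    (hdeg : ∀ i, (lam i).totalDegree + (w i).length < n)
    (hP : IsQuasiIdentity F n
      (∑ i, algebraMap (CPoly F n) (QPoly F n) (lam i) * monQ F n m (w i))) :
    ∀ i, lam i = 0 := by
  classical
  by_contra! hne
  obtain ⟨i₀, hi₀, hmax⟩ := Finset.exists_max_image (Finset.univ.filter fun i => lam i ≠ 0)
    (fun i => (w i).length) (by simpa [Finset.filter_nonempty_iff] using hne)
  have hlam : lam i₀ ≠ 0 := (Finset.mem_filter.1 hi₀).2
  obtain ⟨μ, hμ⟩ := MvPolynomial.ne_zero_iff.1 hlam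
  have hcard : (μ.support.image fun p => (p.1, p.2.1)).card ≤ (lam i₀).totalDegree := by
    refine Finset.card_image_le.trans (le_trans ?_
      (MvPolynomial.le_totalDegree (MvPolynomial.mem_support_iff.2 hμ)))
    rw [Finset.card_eq_sum_ones]
    exact Finset.sum_le_sum fun p hp => Nat.one_le_iff_ne_zero.2 (Finsupp.mem_support_iff.1 hp)
  obtain ⟨v, l, hv, hl⟩ := exists_level (μ.support.image fun p => (p.1, p.2.1)) (w i₀).length
    (by have := hdeg i₀; rw [Fintype.card_fin]; omega)
  set W : List ℕ := (w i₀).map Fin.val with hW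
  have hlen : W.length = (w i₀).length := by simp [hW]
  rw [← hlen] at hv
  let S : Fin n × Fin n × ℕ → Prop := fun p => l p.1 = l p.2.1 ∨
    ∃ s, ∃ hs : s < W.length, p.1 = v s ∧ p.2.1 = v (s + 1) ∧ p.2.2 = W[s]
  let φ : CPoly F n →ₐ[F] CPoly F n :=
    MvPolynomial.aeval fun p => if S p then MvPolynomial.X p else 0
  let B : ℕ → Matrix (Fin n) (Fin n) (CPoly F n) := fun k => φ.mapMatrix (genMat F n k)
  have hBapp : ∀ k i j, B k i j = if S (i, j, k) then MvPolynomial.X (i, j, k) else 0 := by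
    intro k i j
    simp [B, φ, genMat]
  have hB : ∀ k i j, B k i j ≠ 0 →
      l i = l j ∨ ∃ s, ∃ hs : s < W.length, i = v s ∧ j = v (s + 1) ∧ k = W[s] := by
    intro k i j h
    by_contra hS
    exact h (by rw [hBapp, if_neg hS])
  have hBW : ∀ s, ∀ hs : s < W.length, B W[s] (v s) (v (s + 1)) ≠ 0 := by
    intro s hs
    rw [hBapp, if_pos (Or.inr ⟨s, hs, rfl, rfl, rfl⟩)]
    exact MvPolynomial.X_ne_zero _
  have hB' : ∀ k i j, B k i j ≠ 0 → l j ≤ l i + 1 := by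
    intro k i j h
    rcases hB k i j h with h | ⟨q, hq, rfl, rfl, -⟩
    · omega
    · rw [hv _ hq.le, hv _ hq]
  have hsum : ∑ i, φ (lam i) * (((w i).map Fin.val).map B).prod (v 0) (v W.length) = 0 := by
    have h := congrArg (fun M => φ.mapMatrix M (v 0) (v W.length))
      (PhiQ_eq_zero_of_isQuasiIdentity hP)
    simp only [map_sum, map_zero, Matrix.zero_apply, ← Algebra.smul_def] at h
    rw [Matrix.sum_apply] at h
    rw [← h]
    refine Finset.sum_congr rfl fun i _ => ?_
    have hprod : (((w i).map Fin.val).map B).prod =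
        φ.mapMatrix (((w i).map Fin.val).map (genMat F n)).prod := by
      rw [map_list_prod, List.map_map (g := φ.mapMatrix)]
      rfl
    rw [hprod, map_smul, PhiQ_monQ]
    simp only [AlgHom.mapMatrix_apply, Matrix.map_apply, Matrix.smul_apply, smul_eq_mul, map_mul]
  rw [Finset.sum_eq_single i₀ _ (by simp)] at hsum
  · have hφ : φ (lam i₀) = 0 := (mul_eq_zero.1 hsum).resolve_right
      (list_prod_apply_drop_ne_zero hv hB hBW _ 0 (by simp [hW]) rfl)
    refine hμ ?_
    rw [← coeff_aeval_ite_X S (lam i₀) μ fun p hp =>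
      Or.inl (hl _ (Finset.mem_image_of_mem _ hp))]
    change (φ (lam i₀)).coeff μ = 0
    rw [hφ, MvPolynomial.coeff_zero]
  · intro i _ hi
    by_contra hterm
    have hp := right_ne_zero_of_mul hterm
    have hlami : lam i ≠ 0 := fun h => hterm (by rw [h, map_zero, zero_mul])
    have h1 : (w i).length ≤ (w i₀).length := hmax i (by simpa using hlami)
    have h2 := level_le_of_list_prod_apply_ne_zero hB' _ _ _ hp
    rw [hv _ le_rfl, hv 0 (Nat.zero_le _), List.length_map] at h2
    have h3 := eq_drop_of_list_prod_apply_ne_zero hv hB _ 0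
      (by simp only [List.length_map] at h2 ⊢; omega) hp
    exact hi (hw (List.map_injective_iff.2 Fin.val_injective h3))
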